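/- Let Δ ≥ 1 be an integer and let G be a finite simple graph with Δ(G) ≤ Δ. Then there exists a vertex subset Z ⊆ V(G) such that every connected component of G − Z is a path, |Z| ≤ 8·log₂ Δ, and the number of edges of G with exactly one endpoint in Z is at most 8(Δ + 1)·log₂ Δ. -/

import Mathlib

open scoped Classical

/-- The constraint matrix `M(G) = [[I, B], [Bᵀ, I]]` of the total matching IP,
with rows and columns indexed by `V(G) ⊔ E(G)`. -/
noncomputable def totalMatrix {V : Type*} (G : SimpleGraph V) :
    Matrix (V ⊕ G.edgeSet) (V ⊕ G.edgeSet) ℤ := fun a b =>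
  match a, b with
  | Sum.inl v, Sum.inl w => if v = w then 1 else 0
  | Sum.inl v, Sum.inr e => if v ∈ (e : Sym2 V) then 1 else 0
  | Sum.inr e, Sum.inl v => if v ∈ (e : Sym2 V) then 1 else 0
  | Sum.inr e, Sum.inr f => if e = f then 1 else 0

/-- `Δ(G)`: the maximum absolute value of the determinant of a square submatrix of `M(G)`
(the empty submatrix, of determinant `1`, is allowed). -/
noncomputable def maxSubdet {V : Type*} (G : SimpleGraph V) : ℕ :=
  sSup {d : ℕ | ∃ (k : ℕ) (f g : Fin k → (V ⊕ G.edgeSet)),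
    Function.Injective f ∧ Function.Injective g ∧
    d = ((totalMatrix G).submatrix f g).det.natAbs}

/-- `x` lives on the vertex set `S`. -/
def SuppOn {V : Type*} (G : SimpleGraph V) (S : Finset V) : V ⊕ G.edgeSet → Prop
  | Sum.inl v => v ∈ S
  | Sum.inr e => ∀ v ∈ (e : Sym2 V), v ∈ S

/-- there is a square submatrix supported on `S` of absolute determinant `d`. -/
def HasDet {V : Type*} (G : SimpleGraph V) (S : Finset V) (d : ℕ) : Prop :=
  ∃ (k : ℕ) (f g : Fin k → (V ⊕ G.edgeSet)),
    Function.Injective f ∧ Function.Injective g ∧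
    (∀ i, SuppOn G S (f i)) ∧ (∀ i, SuppOn G S (g i)) ∧
    d = ((totalMatrix G).submatrix f g).det.natAbs

lemma HasDet.mk' {V : Type*} {G : SimpleGraph V} {S : Finset V} {d : ℕ}
    {ι : Type*} [Fintype ι] [DecidableEq ι] (f g : ι → (V ⊕ G.edgeSet))
    (hf : Function.Injective f) (hg : Function.Injective g)
    (hfS : ∀ i, SuppOn G S (f i)) (hgS : ∀ i, SuppOn G S (g i))
    (hd : d = ((totalMatrix G).submatrix f g).det.natAbs) : HasDet G S d := by
  let e := (Fintype.equivFin ι).symm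
  refine ⟨Fintype.card ι, f ∘ e, g ∘ e, hf.comp e.injective, hg.comp e.injective,
    fun i => hfS _, fun i => hgS _, ?_⟩
  rw [hd, ← Matrix.submatrix_submatrix, Matrix.det_submatrix_equiv_self]

lemma SuppOn.mono {V : Type*} {G : SimpleGraph V} {S T : Finset V} (h : S ⊆ T)
    {x : V ⊕ G.edgeSet} (hx : SuppOn G S x) : SuppOn G T x := by
  rcases x with v | e
  · exact h hx
  · exact fun v hv => h (hx v hv)

lemma HasDet.mono {V : Type*} {G : SimpleGraph V} {S T : Finset V} (h : S ⊆ T) {d : ℕ}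
    (hS : HasDet G S d) : HasDet G T d := by
  obtain ⟨k, f, g, hf, hg, h1, h2, h3⟩ := hS
  exact ⟨k, f, g, hf, hg, fun i => (h1 i).mono h, fun i => (h2 i).mono h, h3⟩

lemma SuppOn.ne {V : Type*} {G : SimpleGraph V} {S T : Finset V} (h : Disjoint S T)
    {x y : V ⊕ G.edgeSet} (hx : SuppOn G S x) (hy : SuppOn G T y) : x ≠ y := by
  rintro rfl
  rcases x with v | ⟨e, he⟩
  · exact Finset.disjoint_left.mp h hx hy
  · induction e with
    | _ a b => exact Finset.disjoint_left.mp h (hx a (by simp)) (hy a (by simp))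

lemma SuppOn.zero {V : Type*} {G : SimpleGraph V} {S T : Finset V} (h : Disjoint S T)
    {x y : V ⊕ G.edgeSet} (hx : SuppOn G S x) (hy : SuppOn G T y) : totalMatrix G x y = 0 := by
  have hne := SuppOn.ne h hx hy
  rw [Finset.disjoint_left] at h
  rcases x with v | e <;> rcases y with w | f
  · exact if_neg (fun hh => hne (by rw [hh]))
  · exact if_neg (fun hh => h hx (hy _ hh))
  · exact if_neg (fun hh => h (hx _ hh) hy)
  · exact if_neg (fun hh => hne (by rw [hh]))

lemma HasDet.union {V : Type*} {G : SimpleGraph V} {S T : Finset V} (h : Disjoint S T)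
    {d d' : ℕ} (hS : HasDet G S d) (hT : HasDet G T d') : HasDet G (S ∪ T) (d * d') := by
  obtain ⟨k, f, g, hf, hg, h1, h2, h3⟩ := hS
  obtain ⟨k', f', g', hf', hg', h1', h2', h3'⟩ := hT
  refine HasDet.mk' (Sum.elim f f') (Sum.elim g g') ?_ ?_ ?_ ?_ ?_
  · exact hf.sumElim hf' (fun a b => SuppOn.ne h (h1 a) (h1' b))
  · exact hg.sumElim hg' (fun a b => SuppOn.ne h (h2 a) (h2' b))
  · rintro (i | i)
    · exact (h1 i).mono Finset.subset_union_left
    · exact (h1' i).mono Finset.subset_union_right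
  · rintro (i | i)
    · exact (h2 i).mono Finset.subset_union_left
    · exact (h2' i).mono Finset.subset_union_right
  · have : (totalMatrix G).submatrix (Sum.elim f f') (Sum.elim g g') =
        Matrix.fromBlocks ((totalMatrix G).submatrix f g) 0 0
          ((totalMatrix G).submatrix f' g') := by
      ext i j
      rcases i with i | i <;> rcases j with j | j
      · rfl
      · exact SuppOn.zero h (h1 i) (h2' j)
      · exact SuppOn.zero h.symm (h1' i) (h2 j)
      · rfl
    rw [this, Matrix.det_fromBlocks_zero₂₁, Int.natAbs_mul, h3, h3']

lemma HasDet.le {V : Type*} [Fintype V] {G : SimpleGraph V} {S : Finset V} {d : ℕ}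
    (hS : HasDet G S d) : d ≤ maxSubdet G := by
  obtain ⟨k, f, g, hf, hg, h1, h2, h3⟩ := hS
  refine le_csSup (Set.Finite.bddAbove ?_) ⟨k, f, g, hf, hg, h3⟩
  refine Set.Finite.subset (s := ⋃ k ∈ Finset.range (Fintype.card (V ⊕ G.edgeSet) + 1),
    Set.range (fun fg : (Fin k → (V ⊕ G.edgeSet)) × (Fin k → (V ⊕ G.edgeSet)) =>
      ((totalMatrix G).submatrix fg.1 fg.2).det.natAbs)) ?_ ?_
  · exact Set.Finite.biUnion (Finset.finite_toSet _) (fun _ _ => Set.finite_range _)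
  · rintro d ⟨k, f, g, hf, hg, rfl⟩
    simp only [Set.mem_iUnion]
    refine ⟨k, ?_, ⟨(f, g), rfl⟩⟩
    have := Fintype.card_le_of_injective f hf
    simp only [Fintype.card_fin] at this
    simp only [Finset.mem_range]
    omega

lemma hasDet_star {V : Type*} (G : SimpleGraph V) (v : V) (N : Finset V)
    (hN : ∀ w ∈ N, G.Adj v w) : HasDet G (insert v N) ((1 - (N.card : ℤ)).natAbs) := by
  let E : N → G.edgeSet := fun w => ⟨s(v, w), hN w w.2⟩
  have hE : Function.Injective E := by
    intro a b hab
    have : s(v, (a : V)) = s(v, (b : V)) := congrArg Subtype.val hab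
    have h2 : (a : V) = b := by
      rw [Sym2.eq_iff] at this
      rcases this with ⟨_, h⟩ | ⟨h, h'⟩
      · exact h
      · exact h'.trans h
    exact Subtype.ext h2
  let f : Unit ⊕ N → V ⊕ G.edgeSet := Sum.map (fun _ => v) E
  have hf : Function.Injective f := Sum.map_injective.mpr ⟨fun _ _ _ => rfl, hE⟩
  have hs : ∀ i, SuppOn G (insert v N) (f i) := by
    rintro (i | i)
    · exact Finset.mem_insert_self v N
    · intro w hw
      have : w = v ∨ w = i := by simpa [E] using hw
      rcases this with rfl | rfl
      · simp
      · simp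
  refine HasDet.mk' f f hf hf hs hs ?_
  have : (totalMatrix G).submatrix f f =
      Matrix.fromBlocks 1 (Matrix.of fun _ _ => 1) (Matrix.of fun _ _ => 1) 1 := by
    ext i j
    rcases i with i | i <;> rcases j with j | j
    · simp [f, totalMatrix]
    · simp [f, totalMatrix, E]
    · simp [f, totalMatrix, E]
    · simp only [Matrix.submatrix_apply, f, Sum.map_inr, totalMatrix, hE.eq_iff,
        Matrix.fromBlocks_apply₂₂, Matrix.one_apply]
  rw [this, Matrix.det_fromBlocks_one₂₂]
  simp [Matrix.mul_apply]

/-- cyclic adjacency of rows and columns -/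
def cyc (m i j : ℕ) : Prop := j = i ∨ j + 1 = i ∨ (i = 0 ∧ j + 1 = m)

lemma det_cyc (m : ℕ) (hm : Odd m) (hm3 : 3 ≤ m) (A : Matrix (Fin m) (Fin m) ℤ)
    (hA : ∀ i j : Fin m, A i j = if cyc m i j then 1 else 0) : 2 ≤ A.det.natAbs := by
  let prev : Fin m → Fin m := fun i =>
    if (i : ℕ) = 0 then ⟨m - 1, by omega⟩ else ⟨(i : ℕ) - 1, by omega⟩
  have hprev : ∀ i, prev i ≠ i := by
    intro i h
    have := congrArg Fin.val h
    simp only [prev] at this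
    split_ifs at this <;> simp at this <;> omega
  have hcyc : ∀ i j : Fin m, cyc m i j ↔ j = i ∨ j = prev i := by
    intro i j
    simp only [cyc, prev, Fin.ext_iff]
    split_ifs <;> simp <;> omega
  have hmul : ∀ {R : Type} [CommRing R] (v : Fin m → R) (i : Fin m),
      ∑ j : Fin m, (if cyc m i j then (1 : R) else 0) * v j = v i + v (prev i) := by
    intro R _ v i
    have : ∀ j : Fin m, (if cyc m i j then (1 : R) else 0) * v j =
        (if j = i then v j else 0) + (if j = prev i then v j else 0) := by
      intro j
      by_cases h1 : j = i
      · subst h1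
        simp [hcyc, (hprev j).symm]
      · simp [hcyc, h1]
    simp [this, Finset.sum_add_distrib]
  have h0 : A.det ≠ 0 := by
    intro h
    obtain ⟨v, hv, hAv⟩ := Matrix.exists_mulVec_eq_zero_iff.mpr h
    have hrel : ∀ i, v i + v (prev i) = 0 := by
      intro i
      have := congrFun hAv i
      simp only [Matrix.mulVec, dotProduct, hA, Pi.zero_apply] at this
      rwa [hmul] at this
    have hpow : ∀ k (hk : k < m), v ⟨k, hk⟩ = (-1) ^ k * v ⟨0, by omega⟩ := by
      intro k
      induction k with
      | zero => intro hk; simp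
      | succ k ih =>
        intro hk
        have h1 := hrel ⟨k + 1, hk⟩
        have h2 : prev ⟨k + 1, hk⟩ = ⟨k, by omega⟩ := by simp [prev]
        rw [h2, ih (by omega)] at h1
        rw [pow_succ]
        linarith
    have hz : v ⟨0, by omega⟩ = 0 := by
      have h1 := hrel ⟨0, by omega⟩
      have h2 : prev ⟨0, by omega⟩ = ⟨m - 1, by omega⟩ := by simp [prev]
      have h3 : Even (m - 1) := by
        obtain ⟨r, hr⟩ := hm
        exact ⟨r, by omega⟩
      rw [h2, hpow (m - 1), h3.neg_one_pow] at h1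
      linarith
    apply hv
    ext i
    rw [hpow i i.2, hz]
    simp
  have h2 : ((A.det : ℤ) : ZMod 2) = 0 := by
    have e1 : ((A.det : ℤ) : ZMod 2) = (A.map (Int.castRingHom (ZMod 2))).det := by
      have := RingHom.map_det (Int.castRingHom (ZMod 2)) A
      simpa using this
    rw [e1]
    apply Matrix.exists_mulVec_eq_zero_iff.mp
    refine ⟨fun _ => 1, fun h => one_ne_zero (congrFun h ⟨0, by omega⟩), ?_⟩
    ext i
    have : ∀ j, (A.map (Int.castRingHom (ZMod 2))) i j =
        if cyc m i j then (1 : ZMod 2) else 0 := by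
      intro j
      simp [hA]
    simp only [Matrix.mulVec, dotProduct, this, Pi.zero_apply]
    rw [hmul (fun _ => (1 : ZMod 2))]
    decide
  have h3 : (2 : ℤ) ∣ A.det := (ZMod.intCast_zmod_eq_zero_iff_dvd A.det 2).mp h2
  have h4 : A.det.natAbs ≠ 0 := Int.natAbs_ne_zero.mpr h0
  have h5 : 2 ∣ A.det.natAbs := Int.natCast_dvd.mp h3
  exact Nat.le_of_dvd (Nat.pos_of_ne_zero h4) h5

/-- a path with `n` vertices inside `U`, given by `p 0, …, p (n-1)`. -/
def IsP {V : Type*} (G : SimpleGraph V) (U : Finset V) (p : ℕ → V) (n : ℕ) : Prop :=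
  (∀ i < n, p i ∈ U) ∧ (∀ i < n, ∀ j < n, p i = p j → i = j) ∧
    (∀ i, i + 1 < n → G.Adj (p i) (p (i + 1)))

lemma hasDet_cycle {V : Type*} (G : SimpleGraph V) (U : Finset V) (p : ℕ → V) (n : ℕ)
    (hn : 3 ≤ n) (hp : IsP G U p n) (hcl : G.Adj (p 0) (p (n - 1))) :
    ∃ d, 2 ≤ d ∧ HasDet G ((Finset.range n).image p) d := by
  obtain ⟨-, hinj, hadj⟩ := hp
  have hpi : ∀ i < n, ∀ j < n, (p i = p j ↔ i = j) :=
    fun i hi j hj => ⟨hinj i hi j hj, fun h => by rw [h]⟩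
  let nxt : ℕ → ℕ := fun i => if i + 1 < n then i + 1 else 0
  have hnxt : ∀ i, nxt i < n := by
    intro i; simp only [nxt]; split_ifs <;> omega
  have hnspec : ∀ i, (nxt i = i + 1 ∧ i + 1 < n) ∨ (nxt i = 0 ∧ n ≤ i + 1) := by
    intro i
    by_cases h : i + 1 < n
    · exact Or.inl ⟨if_pos h, h⟩
    · exact Or.inr ⟨if_neg h, by omega⟩
  have hex : ∀ i, ∃ e : G.edgeSet, i < n → (e : Sym2 V) = s(p i, p (nxt i)) := by
    intro i
    by_cases hi : i < n
    · refine ⟨⟨s(p i, p (nxt i)), ?_⟩, fun _ => rfl⟩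
      rw [SimpleGraph.mem_edgeSet]
      simp only [nxt]
      split_ifs with h
      · exact hadj i h
      · have : i = n - 1 := by omega
        rw [this]
        exact hcl.symm
    · exact ⟨⟨s(p 0, p (n - 1)), hcl⟩, fun h => absurd h hi⟩
  choose E hE using hex
  have hmem : ∀ i < n, ∀ j < n, (p i ∈ (E j : Sym2 V) ↔ i = j ∨ i = nxt j) := by
    intro i hi j hj
    rw [hE j hj, Sym2.mem_iff, hpi i hi j hj, hpi i hi _ (hnxt j)]
  have hEi : ∀ i < n, ∀ j < n, (E i = E j ↔ i = j) := by
    intro i hi j hj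
    refine ⟨fun h => ?_, fun h => by rw [h]⟩
    have h1 : i = j ∨ i = nxt j := (hmem i hi j hj).mp (h ▸ (hmem i hi i hi).mpr (Or.inl rfl))
    have h2 : j = i ∨ j = nxt i := (hmem j hj i hi).mp (h ▸ (hmem j hj j hj).mpr (Or.inl rfl))
    simp only [nxt] at h1 h2
    split_ifs at h1 h2 <;> omega
  have hSp : ∀ i < n, SuppOn G ((Finset.range n).image p) (Sum.inl (p i)) := by
    intro i hi
    exact Finset.mem_image_of_mem p (Finset.mem_range.mpr hi)
  have hSE : ∀ i < n, SuppOn G ((Finset.range n).image p) (Sum.inr (E i)) := by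
    intro i hi v hv
    rw [hE i hi, Sym2.mem_iff] at hv
    rcases hv with rfl | rfl
    · exact Finset.mem_image_of_mem p (Finset.mem_range.mpr hi)
    · exact Finset.mem_image_of_mem p (Finset.mem_range.mpr (hnxt i))
  have mVV : ∀ i < n, ∀ j < n, totalMatrix G (Sum.inl (p i)) (Sum.inl (p j)) =
      if i = j then 1 else 0 := by
    intro i hi j hj
    simp only [totalMatrix, hpi i hi j hj]
  have mVE : ∀ i < n, ∀ j < n, totalMatrix G (Sum.inl (p i)) (Sum.inr (E j)) =
      if i = j ∨ i = nxt j then 1 else 0 := by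
    intro i hi j hj
    simp only [totalMatrix, hmem i hi j hj]
  have mEV : ∀ i < n, ∀ j < n, totalMatrix G (Sum.inr (E j)) (Sum.inl (p i)) =
      if i = j ∨ i = nxt j then 1 else 0 := by
    intro i hi j hj
    simp only [totalMatrix, hmem i hi j hj]
  have mEE : ∀ i < n, ∀ j < n, totalMatrix G (Sum.inr (E i)) (Sum.inr (E j)) =
      if i = j then 1 else 0 := by
    intro i hi j hj
    simp only [totalMatrix, hEi i hi j hj]
  rcases Nat.even_or_odd n with hev | hodd
  · let f : Fin (n + 1) → V ⊕ G.edgeSet := fun i =>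
      if (i : ℕ) = 0 then Sum.inl (p 0) else if (i : ℕ) ≤ 2 then Sum.inr (E (i - 1))
      else Sum.inl (p (i - 1))
    let g : Fin (n + 1) → V ⊕ G.edgeSet := fun i =>
      if (i : ℕ) = 0 then Sum.inr (E 0) else if (i : ℕ) = 1 then Sum.inl (p 1)
      else Sum.inr (E (i - 1))
    refine ⟨_, det_cyc (n + 1) hev.add_one (by omega)
      ((totalMatrix G).submatrix f g) ?_, HasDet.mk' f g ?_ ?_ ?_ ?_ rfl⟩
    · intro i j
      have hi := i.2
      have hj := j.2
      have hx0 := hnspec 0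
      have hxi := hnspec (i - 1)
      have hxj := hnspec (j - 1)
      have key : ∀ r : ℤ, (cyc (n + 1) i j → r = 1) → (¬ cyc (n + 1) i j → r = 0) →
          r = if cyc (n + 1) i j then 1 else 0 := by
        intro r h1 h2
        by_cases hc : cyc (n + 1) i j
        · rw [if_pos hc, h1 hc]
        · rw [if_neg hc, h2 hc]
      apply key <;> intro hc <;> simp only [cyc] at hc <;>
        simp only [Matrix.submatrix_apply, f, g] <;> split_ifs <;>
      first
      | rw [mVV _ (by omega) _ (by omega)]
      | rw [mVE _ (by omega) _ (by omega)]
      | rw [mEV _ (by omega) _ (by omega)]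
      | rw [mEE _ (by omega) _ (by omega)]
      all_goals
        first
        | (apply if_pos; omega)
        | (apply if_neg; omega)
    · intro i j h
      have hi := i.2
      have hj := j.2
      ext
      simp only [f] at h
      split_ifs at h <;> simp at h <;>
      first
      | omega
      | (rw [hpi _ (by omega) _ (by omega)] at h; omega)
      | (rw [hEi _ (by omega) _ (by omega)] at h; omega)
    · intro i j h
      have hi := i.2
      have hj := j.2
      ext
      simp only [g] at h
      split_ifs at h <;> simp at h <;>
      first
      | omega
      | (rw [hpi _ (by omega) _ (by omega)] at h; omega)
      | (rw [hEi _ (by omega) _ (by omega)] at h; omega)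
    · intro i
      have hi := i.2
      simp only [f]
      split_ifs
      · exact hSp _ (by omega)
      · exact hSE _ (by omega)
      · exact hSp _ (by omega)
    · intro i
      have hi := i.2
      simp only [g]
      split_ifs
      · exact hSE _ (by omega)
      · exact hSp _ (by omega)
      · exact hSE _ (by omega)
  · refine ⟨_, det_cyc n hodd hn
      ((totalMatrix G).submatrix (fun i : Fin n => Sum.inl (p i))
        (fun i : Fin n => Sum.inr (E i))) ?_, HasDet.mk' _ _ ?_ ?_ ?_ ?_ rfl⟩
    · intro i j
      have hi := i.2
      have hj := j.2
      rw [Matrix.submatrix_apply, mVE _ i.2 _ j.2]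
      have : ((i : ℕ) = j ∨ (i : ℕ) = nxt j) ↔ cyc n i j := by
        simp only [cyc, nxt]
        split_ifs <;> omega
      simp only [this]
    · intro i j h
      exact Fin.ext (hinj _ i.2 _ j.2 (Sum.inl.inj h))
    · intro i j h
      exact Fin.ext ((hEi _ i.2 _ j.2).mp (Sum.inr.inj h))
    · exact fun i => hSp _ i.2
    · exact fun i => hSE _ i.2

lemma IsP.le_card {V : Type*} {G : SimpleGraph V} {U : Finset V} {p : ℕ → V} {n : ℕ}
    (h : IsP G U p n) : n ≤ U.card := by
  have := Finset.card_le_card_of_injOn (s := Finset.range n) (t := U) p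
    (fun i hi => h.1 i (by simpa using hi))
    (fun i hi j hj e => h.2.1 i (by simpa using hi) j (by simpa using hj) e)
  simpa using this

lemma exists_max_path {V : Type*} (G : SimpleGraph V) (U : Finset V) (hU : U.Nonempty) :
    ∃ n p, 1 ≤ n ∧ IsP G U p n ∧ ∀ q, ¬ IsP G U q (n + 1) := by
  by_contra hcon
  push Not at hcon
  have : ∀ n, 1 ≤ n → ∃ p, IsP G U p n := by
    intro n hn
    induction n, hn using Nat.le_induction with
    | base =>
      obtain ⟨u, hu⟩ := hU
      exact ⟨fun _ => u, fun _ _ => hu, fun i hi j hj _ => by omega, fun i hi => by omega⟩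
    | succ n hn ih =>
      obtain ⟨p, hp⟩ := ih
      exact hcon n p hn hp
  obtain ⟨p, hp⟩ := this (U.card + 1) (by omega)
  have := hp.le_card
  omega

lemma IsP.snoc {V : Type*} {G : SimpleGraph V} {U : Finset V} {p : ℕ → V} {n : ℕ}
    (hn : 1 ≤ n) (h : IsP G U p n) {v : V} (hv : v ∈ U) (ha : G.Adj (p (n - 1)) v)
    (hnew : ∀ j < n, v ≠ p j) : ∃ q, IsP G U q (n + 1) := by
  refine ⟨fun i => if i = n then v else p i, ?_, ?_, ?_⟩
  · intro i hi
    dsimp only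
    split_ifs with h1
    · exact hv
    · exact h.1 i (by omega)
  · intro i hi j hj e
    dsimp only at e
    split_ifs at e with h1 h2 h2
    · omega
    · exact absurd e (hnew j (by omega))
    · exact absurd e.symm (hnew i (by omega))
    · exact h.2.1 i (by omega) j (by omega) e
  · intro i hi
    dsimp only
    rw [if_neg (by omega)]
    split_ifs with h1
    · have : i = n - 1 := by omega
      rw [this]; exact ha
    · exact h.2.2 i (by omega)

lemma IsP.rev {V : Type*} {G : SimpleGraph V} {U : Finset V} {p : ℕ → V} {n : ℕ}
    (h : IsP G U p n) : IsP G U (fun i => p (n - 1 - i)) n := by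
  refine ⟨fun i hi => h.1 _ (by omega), fun i hi j hj e => ?_, fun i hi => ?_⟩
  · have := h.2.1 _ (by omega) _ (by omega) e
    omega
  · have := h.2.2 (n - 1 - (i + 1)) (by omega)
    rw [show n - 1 - (i + 1) + 1 = n - 1 - i by omega] at this
    exact this.symm

/-- no vertex of `U` has three neighbours in `U` -/
def Deg2 {V : Type*} (G : SimpleGraph V) (U : Finset V) : Prop :=
  ∀ v ∈ U, ∀ a ∈ U, ∀ b ∈ U, ∀ c ∈ U, G.Adj v a → G.Adj v b → G.Adj v c →
    a = b ∨ a = c ∨ b = c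

lemma max_path_interior {V : Type*} {G : SimpleGraph V} {U : Finset V} (hU : Deg2 G U)
    {p : ℕ → V} {n : ℕ} (h : IsP G U p n) {i : ℕ} (hi0 : 0 < i)
    (hi : i + 1 < n) {v : V} (hv : v ∈ U) (ha : G.Adj (p i) v) :
    v = p (i + 1) ∨ v = p (i - 1) := by
  have h1 := h.2.2 (i - 1) (by omega)
  rw [show i - 1 + 1 = i by omega] at h1
  rcases hU (p i) (h.1 i (by omega)) (p (i + 1)) (h.1 _ (by omega)) (p (i - 1))
    (h.1 _ (by omega)) v hv (h.2.2 i hi) h1.symm ha with e | e | e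
  · have := h.2.1 _ (by omega) _ (by omega) e
    omega
  · exact Or.inl e.symm
  · exact Or.inr e.symm

lemma max_path_last {V : Type*} {G : SimpleGraph V} {U : Finset V} (hU : Deg2 G U)
    {p : ℕ → V} {n : ℕ} (hn : 1 ≤ n) (h : IsP G U p n) (hmax : ∀ q, ¬ IsP G U q (n + 1))
    {v : V} (hv : v ∈ U) (ha : G.Adj (p (n - 1)) v) :
    ∃ j < n, v = p j ∧ (j + 1 = n - 1 ∨ (j = 0 ∧ 3 ≤ n)) := by
  have hex : ∃ j < n, v = p j := by
    by_contra hcon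
    push Not at hcon
    obtain ⟨q, hq⟩ := h.snoc hn hv ha hcon
    exact hmax q hq
  obtain ⟨j, hj, rfl⟩ := hex
  have hjn : j ≠ n - 1 := by
    rintro rfl
    exact G.irrefl ha
  refine ⟨j, hj, rfl, ?_⟩
  rcases Nat.eq_zero_or_pos j with rfl | hj0
  · omega
  · rcases max_path_interior hU h hj0 (by omega) (h.1 (n - 1) (by omega)) ha.symm with e | e
    · have := h.2.1 _ (by omega) _ (by omega) e
      omega
    · have := h.2.1 _ (by omega) _ (by omega) e
      omega

lemma max_path_nbr {V : Type*} {G : SimpleGraph V} {U : Finset V} (hU : Deg2 G U)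
    {p : ℕ → V} {n : ℕ} (hn : 1 ≤ n) (h : IsP G U p n) (hmax : ∀ q, ¬ IsP G U q (n + 1))
    {i : ℕ} (hi : i < n) {v : V} (hv : v ∈ U) (ha : G.Adj (p i) v) :
    ∃ j < n, v = p j ∧ (j = i + 1 ∨ i = j + 1 ∨
      (3 ≤ n ∧ ((i = 0 ∧ j = n - 1) ∨ (j = 0 ∧ i = n - 1)))) := by
  by_cases hlast : i = n - 1
  · subst hlast
    obtain ⟨j, hj, e, hh⟩ := max_path_last hU hn h hmax hv ha
    exact ⟨j, hj, e, by omega⟩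
  by_cases h0 : i = 0
  · subst h0
    obtain ⟨j, hj, e, hh⟩ := max_path_last hU hn h.rev hmax hv
      (by simpa using ha)
    exact ⟨n - 1 - j, by omega, e, by omega⟩
  · rcases max_path_interior hU h (by omega) (by omega) hv ha with e | e
    · exact ⟨i + 1, by omega, e, by omega⟩
    · exact ⟨i - 1, by omega, e, by omega⟩

/-- every vertex of `W` lies in an induced path closed under adjacency in `W`. -/
def PathDec {V : Type*} (G : SimpleGraph V) (W : Finset V) : Prop :=
  ∀ v ∈ W, ∃ (n : ℕ) (p : ℕ → V), (∃ i < n, p i = v) ∧ (∀ i < n, p i ∈ W) ∧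
    (∀ i < n, ∀ j < n, p i = p j → i = j) ∧
    (∀ i < n, ∀ j < n, (G.Adj (p i) (p j) ↔ i + 1 = j ∨ j + 1 = i)) ∧
    (∀ i < n, ∀ w ∈ W, G.Adj (p i) w → ∃ j < n, p j = w)

lemma PathDec.add {V : Type*} {G : SimpleGraph V} {W : Finset V} (hW : PathDec G W)
    (n : ℕ) (p : ℕ → V) (hinj : ∀ i < n, ∀ j < n, p i = p j → i = j)
    (hadj : ∀ i < n, ∀ j < n, (G.Adj (p i) (p j) ↔ i + 1 = j ∨ j + 1 = i))
    (hno : ∀ i < n, ∀ w ∈ W, ¬ G.Adj (p i) w) :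
    PathDec G (W ∪ (Finset.range n).image p) := by
  intro v hv
  rcases Finset.mem_union.mp hv with hv | hv
  · obtain ⟨m, q, h1, h2, h3, h4, h5⟩ := hW v hv
    refine ⟨m, q, h1, fun i hi => Finset.mem_union_left _ (h2 i hi), h3, h4, ?_⟩
    intro i hi w hw ha
    rcases Finset.mem_union.mp hw with hw | hw
    · exact h5 i hi w hw ha
    · obtain ⟨k, hk, rfl⟩ := Finset.mem_image.mp hw
      exact absurd ha.symm (hno k (by simpa using hk) _ (h2 i hi))
  · obtain ⟨k, hk, rfl⟩ := Finset.mem_image.mp hv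
    refine ⟨n, p, ⟨k, by simpa using hk, rfl⟩, fun i hi => Finset.mem_union_right _
      (Finset.mem_image_of_mem p (Finset.mem_range.mpr hi)), hinj, hadj, ?_⟩
    intro i hi w hw ha
    rcases Finset.mem_union.mp hw with hw | hw
    · exact absurd ha (hno i hi w hw)
    · obtain ⟨k, hk, rfl⟩ := Finset.mem_image.mp hw
      exact ⟨k, by simpa using hk, rfl⟩

lemma main_induction {V : Type*} (G : SimpleGraph V) : ∀ (m : ℕ) (U : Finset V), U.card = m →
    ∃ (Z : Finset V) (k d : ℕ), Z ⊆ U ∧ Z.card ≤ 4 * k ∧ 2 ^ k ≤ d ∧ HasDet G U d ∧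
      PathDec G (U \ Z) := by
  intro m
  induction m using Nat.strong_induction_on with
  | _ m ih =>
  intro U hUm
  have hprod : ∀ {S : Finset V} {d d' k : ℕ}, S ⊆ U → 2 ≤ d' → HasDet G S d' → 2 ^ k ≤ d →
      HasDet G (U \ S) d → ∃ e, 2 ^ (k + 1) ≤ e ∧ HasDet G U e := by
    intro S d d' k hS h2 hd' hk hd
    refine ⟨d * d', ?_, ?_⟩
    · rw [pow_succ]
      exact Nat.mul_le_mul hk h2
    · exact (hd.union Finset.sdiff_disjoint hd').mono
        (Finset.union_subset Finset.sdiff_subset hS)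
  by_cases hdeg : Deg2 G U
  · rcases U.eq_empty_or_nonempty with rfl | hne
    · refine ⟨∅, 0, 1, by simp, by simp, by simp, ?_, ?_⟩
      · exact ⟨0, Fin.elim0, Fin.elim0, fun i => i.elim0, fun i => i.elim0, fun i => i.elim0,
          fun i => i.elim0, by simp⟩
      · intro v hv
        simp at hv
    · obtain ⟨n, p, hn, hp, hmax⟩ := exists_max_path G U hne
      let S := (Finset.range n).image p
      have hSmem : ∀ i < n, p i ∈ S :=
        fun i hi => Finset.mem_image_of_mem p (Finset.mem_range.mpr hi)
      have hSU : S ⊆ U := by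
        intro x hx
        obtain ⟨i, hi, rfl⟩ := Finset.mem_image.mp hx
        exact hp.1 i (by simpa using hi)
      have hlt : (U \ S).card < m := by
        rw [← hUm]
        apply Finset.card_lt_card
        refine ⟨Finset.sdiff_subset, fun h => ?_⟩
        have := h (hp.1 0 (by omega))
        exact (Finset.mem_sdiff.mp this).2 (hSmem 0 (by omega))
      obtain ⟨Z, k, d, hZU, hZk, hkd, hd, hPD⟩ := ih _ hlt (U \ S) rfl
      have hno : ∀ i < n, ∀ w ∈ (U \ S) \ Z, ¬ G.Adj (p i) w := by
        intro i hi w hw ha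
        have hw' := Finset.mem_sdiff.mp (Finset.mem_sdiff.mp hw).1
        obtain ⟨j, hj, e, -⟩ := max_path_nbr hdeg hn hp hmax hi hw'.1 ha
        exact hw'.2 (e ▸ hSmem j hj)
      have hadj : ∀ i < n, ∀ j < n, (i + 1 = j ∨ j + 1 = i) → G.Adj (p i) (p j) := by
        rintro i hi j hj (rfl | rfl)
        · exact hp.2.2 i hj
        · exact (hp.2.2 j hi).symm
      by_cases hcyc : 3 ≤ n ∧ G.Adj (p 0) (p (n - 1))
      · obtain ⟨d', hd'2, hd'⟩ := hasDet_cycle G U p n hcyc.1 hp hcyc.2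
        obtain ⟨e, he, hUe⟩ := hprod hSU hd'2 hd' hkd hd
        refine ⟨insert (p (n - 1)) Z, k + 1, e, ?_, ?_, he, hUe, ?_⟩
        · exact Finset.insert_subset (hp.1 _ (by omega)) (hZU.trans Finset.sdiff_subset)
        · have := Finset.card_insert_le (p (n - 1)) Z
          omega
        · have hEq : U \ insert (p (n - 1)) Z =
              ((U \ S) \ Z) ∪ (Finset.range (n - 1)).image p := by
            ext x
            simp only [Finset.mem_sdiff, Finset.mem_insert, Finset.mem_union, not_or]
            constructor
            · rintro ⟨h1, h2, h3⟩
              by_cases hx : x ∈ S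
              · right
                obtain ⟨i, hi, rfl⟩ := Finset.mem_image.mp hx
                rw [Finset.mem_range] at hi
                have : i ≠ n - 1 := fun h => h2 (by rw [h])
                exact Finset.mem_image_of_mem p (Finset.mem_range.mpr (by omega))
              · exact Or.inl ⟨⟨h1, hx⟩, h3⟩
            · rintro (⟨⟨h1, h2⟩, h3⟩ | h)
              · refine ⟨h1, ?_, h3⟩
                rintro rfl
                exact h2 (hSmem _ (by omega))
              · obtain ⟨i, hi, rfl⟩ := Finset.mem_image.mp h
                rw [Finset.mem_range] at hi
                refine ⟨hp.1 i (by omega), fun h => ?_, fun h => ?_⟩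
                · have := hp.2.1 _ (by omega) _ (by omega) h
                  omega
                · exact (Finset.mem_sdiff.mp (hZU h)).2 (hSmem i (by omega))
          rw [hEq]
          apply hPD.add
          · exact fun i hi j hj => hp.2.1 i (by omega) j (by omega)
          · intro i hi j hj
            refine ⟨fun ha => ?_, hadj i (by omega) j (by omega)⟩
            obtain ⟨j', hj', e, h⟩ := max_path_nbr hdeg hn hp hmax (i := i) (by omega)
              (hp.1 j (by omega)) ha
            have := hp.2.1 _ (by omega) _ (by omega) e
            omega
          · exact fun i hi => hno i (by omega)
      · refine ⟨Z, k, d, hZU.trans Finset.sdiff_subset, hZk, hkd,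
          hd.mono Finset.sdiff_subset, ?_⟩
        have hEq : U \ Z = ((U \ S) \ Z) ∪ (Finset.range n).image p := by
          change U \ Z = ((U \ S) \ Z) ∪ S
          ext x
          simp only [Finset.mem_sdiff, Finset.mem_union]
          constructor
          · rintro ⟨h1, h3⟩
            by_cases hx : x ∈ S
            · exact Or.inr hx
            · exact Or.inl ⟨⟨h1, hx⟩, h3⟩
          · rintro (⟨⟨h1, h2⟩, h3⟩ | h)
            · exact ⟨h1, h3⟩
            · exact ⟨hSU h, fun h' => (Finset.mem_sdiff.mp (hZU h')).2 h⟩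
        rw [hEq]
        apply hPD.add
        · exact hp.2.1
        · intro i hi j hj
          refine ⟨fun ha => ?_, hadj i hi j hj⟩
          obtain ⟨j', hj', e, h⟩ := max_path_nbr hdeg hn hp hmax hi (hp.1 j hj) ha
          have hjj := hp.2.1 _ (by omega) _ (by omega) e
          subst hjj
          rcases h with h | h | ⟨h3, ⟨rfl, rfl⟩ | ⟨rfl, rfl⟩⟩
          · omega
          · omega
          · exact absurd ⟨h3, ha⟩ hcyc
          · exact absurd ⟨h3, ha.symm⟩ hcyc
        · exact hno
  · simp only [Deg2] at hdeg
    push Not at hdeg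
    obtain ⟨v, hv, a, ha, b, hb, c, hc, hva, hvb, hvc, hab, hac, hbc⟩ := hdeg
    have hcard : ({a, b, c} : Finset V).card = 3 := Finset.card_eq_three.mpr
      ⟨a, b, c, hab, hac, hbc, rfl⟩
    have hdet := hasDet_star G v {a, b, c} (by
      intro w hw
      simp only [Finset.mem_insert, Finset.mem_singleton] at hw
      rcases hw with rfl | rfl | rfl <;> assumption)
    rw [hcard] at hdet
    set S : Finset V := insert v {a, b, c} with hS
    have hS4 : S.card ≤ 4 := (Finset.card_insert_le _ _).trans (by omega)
    have hSU : S ⊆ U := by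
      intro w hw
      simp only [hS, Finset.mem_insert, Finset.mem_singleton] at hw
      rcases hw with rfl | rfl | rfl | rfl <;> assumption
    have hlt : (U \ S).card < m := by
      rw [← hUm]
      apply Finset.card_lt_card
      refine ⟨Finset.sdiff_subset, fun h => ?_⟩
      exact (Finset.mem_sdiff.mp (h hv)).2 (Finset.mem_insert_self _ _)
    obtain ⟨Z, k, d, hZU, hZk, hkd, hd, hPD⟩ := ih _ hlt (U \ S) rfl
    obtain ⟨e, he, hUe⟩ := hprod hSU (by decide) hdet hkd hd
    refine ⟨S ∪ Z, k + 1, e, Finset.union_subset hSU (hZU.trans Finset.sdiff_subset), ?_, he,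
      hUe, ?_⟩
    · have := Finset.card_union_le S Z
      omega
    · rwa [sdiff_sdiff_left] at hPD

lemma PathDec.comp {V : Type*} [Fintype V] {G : SimpleGraph V} {Z : Finset V}
    (h : PathDec G (Finset.univ \ Z))
    (c : (G.induce ((↑Z : Set V)ᶜ)).ConnectedComponent) :
    ∃ n : ℕ, Nonempty ((G.induce ((↑Z : Set V)ᶜ)).induce c.supp ≃g
          SimpleGraph.pathGraph n) := by
  induction c using SimpleGraph.ConnectedComponent.ind with
  | _ v =>
  obtain ⟨n, p, ⟨i0, hi0, hpi0⟩, hW, hinj, hadj, hcl⟩ := h v.1 (by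
    simpa using (show v.1 ∉ (Z : Set V) from v.2))
  have hZ : ∀ i < n, p i ∈ ((↑Z : Set V)ᶜ) := by
    intro i hi
    have := hW i hi
    simpa using this
  let H := G.induce ((↑Z : Set V)ᶜ)
  -- consecutive vertices are reachable
  have hreach0 : ∀ i (hi : i < n), H.Reachable ⟨p 0, hZ 0 (by omega)⟩ ⟨p i, hZ i hi⟩ := by
    intro i
    induction i with
    | zero => intro hi; exact SimpleGraph.Reachable.refl _
    | succ i ih =>
      intro hi
      refine (ih (by omega)).trans (SimpleGraph.Adj.reachable ?_)
      exact (hadj i (by omega) (i + 1) hi).mpr (Or.inl rfl)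
  have hv : v = ⟨p i0, hZ i0 hi0⟩ := Subtype.ext hpi0.symm
  have hmem : ∀ i (hi : i < n), (⟨p i, hZ i hi⟩ : ((↑Z : Set V)ᶜ : Set V)) ∈
      (H.connectedComponentMk v).supp := by
    intro i hi
    rw [SimpleGraph.ConnectedComponent.mem_supp_iff, SimpleGraph.ConnectedComponent.eq, hv]
    exact (hreach0 i hi).symm.trans (hreach0 i0 hi0)
  have hwalk : ∀ (x y : ((↑Z : Set V)ᶜ : Set V)), H.Walk x y → (∃ i < n, p i = x.1) →
      ∃ i < n, p i = y.1 := by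
    intro x y w
    induction w with
    | nil => exact id
    | cons hxy _ ih =>
      rintro ⟨i, hi, e⟩
      apply ih
      rename_i v' _ _
      refine hcl i hi v'.1 ?_ ?_
      · simpa using (show v'.1 ∉ (Z : Set V) from v'.2)
      · rw [e]
        exact hxy
  let F : Fin n → (H.connectedComponentMk v).supp := fun i => ⟨⟨p i, hZ i i.2⟩, hmem i i.2⟩
  have hF : Function.Bijective F := by
    constructor
    · intro i j e
      have : p i = p j := congrArg (fun x => x.1.1) e
      exact Fin.ext (hinj _ i.2 _ j.2 this)
    · rintro ⟨y, hy⟩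
      rw [SimpleGraph.ConnectedComponent.mem_supp_iff, SimpleGraph.ConnectedComponent.eq] at hy
      obtain ⟨w⟩ := hy.symm
      obtain ⟨i, hi, e⟩ := hwalk _ _ w ⟨i0, hi0, hpi0⟩
      exact ⟨⟨i, hi⟩, Subtype.ext (Subtype.ext e)⟩
  refine ⟨n, ⟨SimpleGraph.Iso.symm ⟨Equiv.ofBijective F hF, ?_⟩⟩⟩
  intro i j
  rw [SimpleGraph.pathGraph_adj]
  exact hadj i i.2 j j.2

/-- Let `Δ ≥ 1` be an integer and `G` a finite simple graph with `Δ(G) ≤ Δ`. Then there is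
a vertex subset `Z` such that every connected component of `G - Z` is a path (possibly a
single vertex), `|Z| ≤ 8 log₂ Δ`, and the number of edges with exactly one endpoint in `Z`
is at most `8 (Δ + 1) log₂ Δ`. -/
theorem stmt12 {V : Type*} [Fintype V] (G : SimpleGraph V)
    (Δ : ℕ) (hΔ : 1 ≤ Δ) (hG : maxSubdet G ≤ Δ) :
    ∃ Z : Finset V,
      (∀ c : (G.induce ((↑Z : Set V)ᶜ)).ConnectedComponent,
        ∃ n : ℕ, Nonempty ((G.induce ((↑Z : Set V)ᶜ)).induce c.supp ≃g
          SimpleGraph.pathGraph n)) ∧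
      (Z.card : ℝ) ≤ 8 * Real.logb 2 Δ ∧
      ((G.edgeFinset.filter fun e =>
        ∃ a b : V, e = s(a, b) ∧ a ∈ Z ∧ b ∉ Z).card : ℝ) ≤
        8 * (Δ + 1) * Real.logb 2 Δ := by
  obtain ⟨Z, k, d, -, hZk, hkd, hd, hPD⟩ := main_induction G _ Finset.univ rfl
  have hlog : (k : ℝ) ≤ Real.logb 2 Δ := by
    have h1 : 2 ^ k ≤ Δ := hkd.trans (hd.le.trans hG)
    rw [Real.le_logb_iff_rpow_le (by norm_num) (by exact_mod_cast hΔ), Real.rpow_natCast]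
    exact_mod_cast h1
  have hZ4 : (Z.card : ℝ) ≤ 4 * k := by exact_mod_cast hZk
  have hk0 : (0 : ℝ) ≤ k := Nat.cast_nonneg k
  have hZ8 : (Z.card : ℝ) ≤ 8 * Real.logb 2 Δ := by linarith
  refine ⟨Z, fun c => hPD.comp c, hZ8, ?_⟩
  have hdeg : ∀ v, G.degree v ≤ Δ + 1 := by
    intro v
    have h1 := (hasDet_star G v (G.neighborFinset v) (by simp)).le.trans hG
    rw [SimpleGraph.card_neighborFinset_eq_degree] at h1
    omega
  have hcard : (G.edgeFinset.filter fun e =>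
        ∃ a b : V, e = s(a, b) ∧ a ∈ Z ∧ b ∉ Z).card ≤ Z.card * (Δ + 1) := by
    refine (Finset.card_le_card (t := Z.biUnion fun v => G.incidenceFinset v) ?_).trans
      (Finset.card_biUnion_le_card_mul _ _ _ ?_)
    · intro e he
      obtain ⟨h1, a, b, rfl, ha, -⟩ := Finset.mem_filter.mp he
      refine Finset.mem_biUnion.mpr ⟨a, ha, ?_⟩
      rw [SimpleGraph.mem_incidenceFinset]
      exact ⟨by simpa using h1, by simp⟩
    · intro v _
      rw [SimpleGraph.card_incidenceFinset_eq_degree]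
      exact hdeg v
  have hcard' : ((G.edgeFinset.filter fun e =>
        ∃ a b : V, e = s(a, b) ∧ a ∈ Z ∧ b ∉ Z).card : ℝ) ≤ Z.card * (Δ + 1) := by
    exact_mod_cast hcard
  have : (Z.card : ℝ) * (Δ + 1) ≤ (8 * Real.logb 2 Δ) * (Δ + 1) :=
    mul_le_mul_of_nonneg_right hZ8 (by positivity)
  linarith
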